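/- For all integers d, ℓ ≥ 0 there exists n such that for every tournament G and every law L in G of order at most ℓ, if χ_L(G) > n then there exist A ∈ L and a subset Q ⊆ V(G)∖A with Q ⇒ A and χ(Q) ≥ d. -/

import Mathlib

structure Tournament where
  V : Type
  fintype : Fintype V
  adj : V → V → Prop
  asymm : ∀ u v, adj u v → ¬ adj v u
  total : ∀ u v, u ≠ v → adj u v ∨ adj v u

attribute [instance] Tournament.fintype

namespace Tournament

/-- A set of vertices is transitive if it includes no cyclic triangle. -/
def IsTransitiveSet (T : Tournament) (A : Set T.V) : Prop :=
  ∀ a ∈ A, ∀ b ∈ A, ∀ c ∈ A, T.adj a b → T.adj b c → ¬ T.adj c a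

/-- The chromatic number of the subtournament induced on `A`. -/
noncomputable def chiOn (T : Tournament) (A : Set T.V) : ℕ :=
  sInf {k | ∃ C : Fin k → Set T.V, (∀ i, T.IsTransitiveSet (C i)) ∧ A ⊆ ⋃ i, C i}

noncomputable def chi (T : Tournament) : ℕ := T.chiOn Set.univ

def outN (T : Tournament) (v : T.V) : Set T.V := {u | T.adj v u}
def inN (T : Tournament) (v : T.V) : Set T.V := {u | T.adj u v}

/-- The domination number of the subtournament induced on `A`. -/
noncomputable def domOn (T : Tournament) (A : Set T.V) : ℕ :=
  sInf {n | ∃ X : Finset T.V, ↑X ⊆ A ∧ (∀ v ∈ A, v ∉ X → ∃ x ∈ X, T.adj x v) ∧ X.card = n}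

noncomputable def dom (T : Tournament) : ℕ := T.domOn Set.univ

/-- `A ⇒ B`: every edge between `A` and `B` is directed from `A` to `B`. -/
def CompleteTo (T : Tournament) (A B : Set T.V) : Prop :=
  ∀ a ∈ A, ∀ b ∈ B, T.adj a b

def CompletePair (T : Tournament) (A B : Set T.V) : Prop :=
  Disjoint A B ∧ T.CompleteTo A B

/-- `G` has a subtournament inside `A` isomorphic to `H`. -/
def ContainsOn (G : Tournament) (A : Set G.V) (H : Tournament) : Prop :=
  ∃ f : H.V → G.V, Function.Injective f ∧ (∀ u, f u ∈ A) ∧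
    ∀ u v, H.adj u v ↔ G.adj (f u) (f v)

def Contains (G H : Tournament) : Prop := G.ContainsOn Set.univ H

def IsHero (H : Tournament) : Prop :=
  ∃ c > 0, ∀ G : Tournament, ¬ G.Contains H → G.chi < c

def IsRebel (H : Tournament) : Prop :=
  ∃ c > 0, ∀ G : Tournament, ¬ G.Contains H → G.dom < c

/-- A law for `G`: a set of subsets of `V(G)`, each including the vertex set of
a cyclic triangle of `G`. -/
def IsLaw (G : Tournament) (L : Set (Set G.V)) : Prop :=
  ∀ A ∈ L, ∃ x ∈ A, ∃ y ∈ A, ∃ z ∈ A, G.adj x y ∧ G.adj y z ∧ G.adj z x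

/-- The `L`-chromatic number: the minimum `k` such that `V(G)` can be covered by
`k` sets, each including no member of `L`. -/
noncomputable def chiLaw (G : Tournament) (L : Set (Set G.V)) : ℕ :=
  sInf {k | ∃ C : Fin k → Set G.V, (∀ i, ∀ A ∈ L, ¬ A ⊆ C i) ∧ ∀ v, ∃ i, v ∈ C i}

end Tournament

/-- `S` is covered by `k` sets with property `F`. -/
def Cov {V : Type} (F : Set V → Prop) (k : ℕ) (S : Set V) : Prop :=
  ∃ C : Fin k → Set V, (∀ i, F (C i)) ∧ S ⊆ ⋃ i, C i

theorem Cov.mono {V : Type} {F : Set V → Prop} {k : ℕ} {S T : Set V}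
    (h : Cov F k T) (hST : S ⊆ T) : Cov F k S := by
  obtain ⟨C, h1, h2⟩ := h
  exact ⟨C, h1, hST.trans h2⟩

theorem Cov.union {V : Type} {F : Set V → Prop} {a b : ℕ} {S T : Set V}
    (h : Cov F a S) (h' : Cov F b T) : Cov F (a + b) (S ∪ T) := by
  obtain ⟨C, h1, h2⟩ := h
  obtain ⟨D, h3, h4⟩ := h'
  refine ⟨Fin.append C D, ?_, ?_⟩
  · intro i
    induction i using Fin.addCases with
    | left i => simpa using h1 i
    | right i => simpa using h3 i
  · rintro x (hx | hx)
    · obtain ⟨i, hi⟩ := Set.mem_iUnion.1 (h2 hx)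
      exact Set.mem_iUnion.2 ⟨Fin.castAdd b i, by simpa using hi⟩
    · obtain ⟨i, hi⟩ := Set.mem_iUnion.1 (h4 hx)
      exact Set.mem_iUnion.2 ⟨Fin.natAdd a i, by simpa using hi⟩

theorem cov_empty {V : Type} {F : Set V → Prop} (hF : F ∅) (k : ℕ) : Cov F k ∅ :=
  ⟨fun _ => ∅, fun _ => hF, by simp⟩

theorem cov_one {V : Type} {F : Set V → Prop} {S : Set V} (hF : F S) : Cov F 1 S :=
  ⟨fun _ => S, fun _ => hF, fun x hx => Set.mem_iUnion.2 ⟨0, hx⟩⟩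

theorem Cov.le {V : Type} {F : Set V → Prop} (hF : F ∅) {a b : ℕ} {S : Set V}
    (h : Cov F a S) (hab : a ≤ b) : Cov F b S := by
  obtain ⟨c, rfl⟩ := Nat.exists_eq_add_of_le hab
  simpa using h.union (cov_empty hF c)

theorem cov_biUnion {V ι : Type} {F : Set V → Prop} (hF : F ∅) (m : ℕ) (X : Finset ι)
    (f : ι → Set V) (h : ∀ x ∈ X, Cov F m (f x)) : Cov F (X.card * m) (⋃ x ∈ X, f x) := by
  classical
  induction X using Finset.induction_on with
  | empty => simpa using cov_empty hF 0
  | insert a s ha ih =>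
    rw [Finset.card_insert_of_notMem ha, Finset.set_biUnion_insert, add_mul, one_mul, add_comm]
    exact (h a (by simp)).union (ih fun x hx => h x (by simp [hx]))

theorem cov_unused {V : Type} {F : Set V → Prop} {j : ℕ} {S : Set V}
    (C : Fin (j + 1) → Set V) (hC : ∀ i, F (C i)) (hS : S ⊆ ⋃ i, C i) (i : Fin (j + 1))
    (hi : ∀ x ∈ S, x ∉ C i) : Cov F j S := by
  refine ⟨fun t => C (i.succAbove t), fun t => hC _, fun x hx => ?_⟩
  obtain ⟨t, ht⟩ := Set.mem_iUnion.1 (hS hx)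
  have : t ≠ i := by rintro rfl; exact hi x hx ht
  obtain ⟨u, rfl⟩ := Fin.exists_succAbove_eq this
  exact Set.mem_iUnion.2 ⟨u, ht⟩

namespace Tournament

theorem irr (G : Tournament) (v : G.V) : ¬ G.adj v v := fun h => G.asymm v v h h

/-- chromatic number at least `k` -/
def Ge (G : Tournament) (k : ℕ) (S : Set G.V) : Prop :=
  ∀ j, Cov G.IsTransitiveSet j S → k ≤ j

theorem trans_empty (G : Tournament) : G.IsTransitiveSet ∅ := by
  intro a ha; exact ha.elim

theorem trans_singleton (G : Tournament) (v : G.V) : G.IsTransitiveSet {v} := by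
  rintro a rfl b rfl c rfl h
  exact (G.irr _ h).elim

/-- `P` is in-dominated by at most `K` of its vertices. -/
def Dom (G : Tournament) (K : ℕ) (P : Set G.V) : Prop :=
  ∃ X : Finset G.V, (∀ x ∈ X, x ∈ P) ∧ X.card ≤ K ∧ ∀ v ∈ P, ∃ x ∈ X, v = x ∨ G.adj v x

theorem Ge.color {G : Tournament} {k : ℕ} {S : Set G.V} (h : G.Ge (k + 1) S)
    (C : Fin (k + 1) → Set G.V) (hC : ∀ i, G.IsTransitiveSet (C i)) (hS : S ⊆ ⋃ i, C i)
    (i : Fin (k + 1)) : ∃ x ∈ S, x ∈ C i := by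
  by_contra hcon
  push Not at hcon
  have := h k (cov_unused C hC hS i hcon)
  omega

theorem not_cov_Ge {G : Tournament} {k : ℕ} {S : Set G.V}
    (h : ¬ Cov G.IsTransitiveSet k S) : G.Ge (k + 1) S := by
  intro j hj
  by_contra hlt
  exact h (hj.le G.trans_empty (by omega))

/-- Large in-domination number forces bounded sets of large chromatic number. -/
theorem dom_or (k : ℕ) : ∃ K s : ℕ, ∀ (G : Tournament) (P : Set G.V),
    G.Dom K P ∨ ∃ B : Finset G.V, (∀ x ∈ B, x ∈ P) ∧ B.card ≤ s ∧ G.Ge k (B : Set G.V) := by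
  classical
  induction k with
  | zero => exact ⟨0, 0, fun G P => Or.inr ⟨∅, by simp, by simp, fun j _ => Nat.zero_le j⟩⟩
  | succ k ih =>
    rcases k with _ | k
    · refine ⟨0, 1, fun G P => ?_⟩
      rcases P.eq_empty_or_nonempty with rfl | ⟨v, hv⟩
      · exact Or.inl ⟨∅, by simp, by simp, by simp⟩
      · refine Or.inr ⟨{v}, by simpa using hv, by simp, ?_⟩
        apply not_cov_Ge
        rintro ⟨C, -, h⟩
        obtain ⟨i, -⟩ := Set.mem_iUnion.1 (h (show v ∈ _ by simp))
        exact i.elim0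
    obtain ⟨K, s, ih⟩ := ih
    obtain ⟨N, hN⟩ : ∃ N, N = (k + 1) * (K + s + 1) + 1 := ⟨_, rfl⟩
    refine ⟨N + K, s + N + 2 ^ N * s, fun G P => ?_⟩
    by_cases hdom : G.Dom (N + K) P
    · exact Or.inl hdom
    right
    -- a minimum dominating set
    have hex : ∃ n, ∃ X : Finset G.V, (∀ x ∈ X, x ∈ P) ∧ X.card = n ∧
        ∀ v ∈ P, ∃ x ∈ X, v = x ∨ G.adj v x :=
      ⟨_, P.toFinset, by simp, rfl, fun v hv => ⟨v, by simpa using hv, Or.inl rfl⟩⟩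
    obtain ⟨D, hDP, hDc, hD⟩ := Nat.find_spec hex
    have hmin : ∀ X : Finset G.V, (∀ x ∈ X, x ∈ P) →
        (∀ v ∈ P, ∃ x ∈ X, v = x ∨ G.adj v x) → D.card ≤ X.card := by
      intro X h1 h2
      rw [hDc]
      exact Nat.find_min' hex ⟨X, h1, rfl, h2⟩
    have hDN : N ≤ D.card := by
      by_contra hlt
      exact hdom ⟨D, hDP, by omega, hD⟩
    obtain ⟨W, hWD, hWc⟩ := Finset.exists_subset_card_eq hDN
    -- A
    obtain ⟨A, hAP, hAc, hA⟩ : ∃ A : Finset G.V,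
        (∀ x ∈ A, x ∈ {v | v ∈ P ∧ ∀ w ∈ W, ¬ (v = w ∨ G.adj v w)}) ∧
        A.card ≤ s ∧ G.Ge (k + 1) (A : Set G.V) := by
      rcases ih G {v | v ∈ P ∧ ∀ w ∈ W, ¬ (v = w ∨ G.adj v w)} with ⟨X, h1, h2, h3⟩ | h
      · exfalso
        refine hdom ⟨W ∪ X, ?_, ?_, ?_⟩
        · intro x hx
          rcases Finset.mem_union.1 hx with hx | hx
          · exact hDP x (hWD hx)
          · exact (h1 x hx).1
        · exact (Finset.card_union_le _ _).trans (by omega)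
        · intro v hv
          by_cases hvW : ∃ w ∈ W, v = w ∨ G.adj v w
          · obtain ⟨w, hw, h⟩ := hvW
            exact ⟨w, Finset.mem_union_left _ hw, h⟩
          · push Not at hvW
            obtain ⟨x, hx, h⟩ := h3 v ⟨hv, fun w hw h => by
              rcases h with h | h
              · exact (hvW w hw).1 h
              · exact (hvW w hw).2 h⟩
            exact ⟨x, Finset.mem_union_right _ hx, h⟩
      · exact h
    have hWA : ∀ w ∈ W, ∀ a ∈ A, G.adj w a := by
      intro w hw a ha
      have := (hAP a ha).2 w hw
      push Not at this
      exact (G.total a w this.1).resolve_left this.2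
    have hAne : ∃ a, a ∈ A := by
      by_contra hcon
      push Not at hcon
      have := hA 0 ((cov_empty G.trans_empty 0).mono fun x hx => (hcon x (by simpa using hx)).elim)
      omega
    obtain ⟨a0, ha0⟩ := hAne
    -- A_S
    have hS : ∀ S : Finset G.V, ∃ B : Finset G.V, B.card ≤ s ∧ (∀ x ∈ B, x ∈ P) ∧
        (S ⊆ W → K + s + 1 < S.card →
        (∀ u ∈ B, (∃ x ∈ S, G.adj u x) ∧ ∀ a ∈ A, G.adj a u) ∧ G.Ge (k + 1) (B : Set G.V)) := by
      intro S
      by_cases hc : S ⊆ W ∧ K + s + 1 < S.card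
      swap
      · exact ⟨∅, by simp, by simp, fun h1 h2 => (hc ⟨h1, h2⟩).elim⟩
      obtain ⟨hSW, hSc⟩ := hc
      rcases ih G {v | v ∈ P ∧ (∃ x ∈ S, v = x ∨ G.adj v x) ∧ ∀ a ∈ A, ¬ (v = a ∨ G.adj v a)} with
        ⟨X, h1, h2, h3⟩ | ⟨B, h1, h2, h3⟩
      · exfalso
        have hle := hmin ((D \ S) ∪ (A ∪ X)) (by
          intro x hx
          simp only [Finset.mem_union, Finset.mem_sdiff] at hx
          rcases hx with hx | hx | hx
          · exact hDP x hx.1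
          · exact (hAP x hx).1
          · exact (h1 x hx).1) (by
          intro v hv
          by_cases hvA : ∃ a ∈ A, v = a ∨ G.adj v a
          · obtain ⟨a, ha, h⟩ := hvA
            exact ⟨a, by simp [ha], h⟩
          obtain ⟨x, hx, h⟩ := hD v hv
          by_cases hxS : x ∈ S
          · obtain ⟨y, hy, h'⟩ := h3 v ⟨hv, ⟨x, hxS, h⟩, fun a ha h'' => hvA ⟨a, ha, h''⟩⟩
            exact ⟨y, by simp [hy], h'⟩
          · exact ⟨x, by simp [hx, hxS], h⟩)
        have e1 := Finset.card_union_le (D \ S) (A ∪ X)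
        have e2 := Finset.card_union_le A X
        have e3 := Finset.card_sdiff_add_card_eq_card (hSW.trans hWD)
        omega
      · refine ⟨B, h2, fun x hx => (h1 x hx).1, fun _ _ => ⟨fun u hu => ?_, h3⟩⟩
        obtain ⟨-, ⟨x, hx, h⟩, h5⟩ := h1 u hu
        refine ⟨⟨x, hx, ?_⟩, fun a ha => ?_⟩
        · rcases h with rfl | h
          · exact (h5 a0 ha0 (Or.inr (hWA _ (hSW hx) _ ha0))).elim
          · exact h
        · have := h5 a ha
          push Not at this
          exact (G.total u a this.1).resolve_left this.2
    choose B hBc hBP hB using hS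
    refine ⟨A ∪ W ∪ W.powerset.biUnion B, ?_, ?_, ?_⟩
    · intro x hx
      simp only [Finset.mem_union, Finset.mem_biUnion] at hx
      rcases hx with (hx | hx) | ⟨S, -, hx⟩
      · exact (hAP x hx).1
      · exact hDP x (hWD hx)
      · exact hBP S x hx
    · have e1 := Finset.card_union_le (A ∪ W) (W.powerset.biUnion B)
      have e2 := Finset.card_union_le A W
      have e3 : (W.powerset.biUnion B).card ≤ W.powerset.card * s :=
        Finset.card_biUnion_le_card_mul _ _ _ fun S _ => hBc S
      rw [Finset.card_powerset, hWc] at e3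
      omega
    · apply not_cov_Ge
      rintro ⟨C, hC, hcov⟩
      have hcol : ∀ x ∈ W, ∃ i, x ∈ C i := fun x hx =>
        Set.mem_iUnion.1 (hcov (by simp [hx]))
      have hcol' : ∀ x : G.V, ∃ i, x ∈ W → x ∈ C i := by
        intro x
        by_cases hx : x ∈ W
        · obtain ⟨i, hi⟩ := hcol x hx
          exact ⟨i, fun _ => hi⟩
        · exact ⟨0, fun h => (hx h).elim⟩
      choose c hc using hcol'
      obtain ⟨i, -, hi⟩ := Finset.exists_lt_card_fiber_of_mul_lt_card_of_maps_to
        (s := W) (t := Finset.univ) (f := c) (n := K + s + 1) (fun _ _ => Finset.mem_univ _)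
        (by rw [hWc, hN, Finset.card_univ, Fintype.card_fin]; omega)
      have hSW : W.filter (fun x => c x = i) ⊆ W := Finset.filter_subset _ _
      obtain ⟨hB1, hB2⟩ := hB _ hSW hi
      obtain ⟨a, ha, hai⟩ := hA.color C hC (fun x hx => hcov (by
        have : x ∈ A := by simpa using hx
        simp [this])) i
      obtain ⟨u, hu, hui⟩ := hB2.color C hC (fun x hx => hcov (by
        simp only [Finset.coe_union, Set.mem_union, Finset.mem_coe, Finset.mem_biUnion]
        exact Or.inr ⟨_, Finset.mem_powerset.2 hSW, hx⟩)) i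
      obtain ⟨⟨x, hx, hux⟩, hau⟩ := hB1 u hu
      obtain ⟨hxW, hxi⟩ := Finset.mem_filter.1 hx
      have hxC : x ∈ C i := hxi ▸ hc x hxW
      exact hC i x hxC a hai u hui (hWA x hxW a ha) (hau a ha) hux

/-- `S` includes no member of `L`. -/
def LF (G : Tournament) (L : Set (Set G.V)) (S : Set G.V) : Prop := ∀ A ∈ L, ¬ A ⊆ S

/-- The standing hypotheses. -/
structure Hyp (d ℓ : ℕ) (G : Tournament) (L : Set (Set G.V)) : Prop where
  law : G.IsLaw L
  ord : ∀ A ∈ L, A.ncard ≤ ℓ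
  inn : ∀ A ∈ L, ∀ Q : Set G.V, G.CompleteTo Q A → Cov G.IsTransitiveSet d Q

theorem Hyp.lf {d ℓ : ℕ} {G : Tournament} {L : Set (Set G.V)} (h : Hyp d ℓ G L)
    {S : Set G.V} (hS : G.IsTransitiveSet S) : G.LF L S := by
  intro A hA hAS
  obtain ⟨x, hx, y, hy, z, hz, h1, h2, h3⟩ := h.law A hA
  exact hS x (hAS hx) y (hAS hy) z (hAS hz) h1 h2 h3

theorem Hyp.cov {d ℓ : ℕ} {G : Tournament} {L : Set (Set G.V)} (h : Hyp d ℓ G L)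
    {S : Set G.V} {k : ℕ} (hS : Cov G.IsTransitiveSet k S) : Cov (G.LF L) k S := by
  obtain ⟨C, h1, h2⟩ := hS
  exact ⟨C, fun i => h.lf (h1 i), h2⟩

theorem Hyp.out {d ℓ : ℕ} {G : Tournament} {L : Set (Set G.V)} (h : Hyp d ℓ G L)
    {O : Set G.V} {m : ℕ} (hO : ¬ Cov (G.LF L) (ℓ * (m + 1) + d) O) :
    G.LF L {v | Cov (G.LF L) m (G.outN v ∩ O)} := by
  classical
  intro A hA hAF
  apply hO
  have h1 := cov_biUnion (h.lf G.trans_empty) (m + 1) A.toFinset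
    (fun a => (G.outN a ∩ O) ∪ {a}) (fun a ha =>
      (hAF (by simpa using ha)).union (cov_one (h.lf (G.trans_singleton a))))
  have h2 := h.cov (h.inn A hA {q | ∀ a ∈ A, G.adj q a} (fun q hq a ha => hq a ha))
  have hc : A.toFinset.card ≤ ℓ := by
    rw [← Set.ncard_eq_toFinset_card']; exact h.ord A hA
  refine ((h1.union h2).le (h.lf G.trans_empty)
    (Nat.add_le_add_right (Nat.mul_le_mul_right _ hc) _)).mono ?_
  intro v hv
  by_cases hq : ∀ a ∈ A, G.adj v a
  · exact Or.inr hq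
  · push Not at hq
    obtain ⟨a, ha, hva⟩ := hq
    left
    refine Set.mem_biUnion (x := a) (by simpa using ha) ?_
    by_cases hav : v = a
    · exact Or.inr hav
    · exact Or.inl ⟨(G.total v a hav).resolve_left hva, hv⟩

theorem exists_inner (d ℓ m : ℕ) : ∃ K f : ℕ, ∀ (G : Tournament) (L : Set (Set G.V)),
    Hyp d ℓ G L → ∀ H : Set G.V, ¬ Cov (G.LF L) f H →
    Cov (G.LF L) K {v | v ∈ H ∧ Cov (G.LF L) m (G.inN v ∩ H)} := by
  classical
  obtain ⟨K, s, hKs⟩ := dom_or (d + 1)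
  refine ⟨K * (m + 1), s * (m + 1) + 1, fun G L h H hH => ?_⟩
  have key : ∀ X : Finset G.V, (∀ x ∈ X, x ∈ {v | v ∈ H ∧ Cov (G.LF L) m (G.inN v ∩ H)}) →
      ∀ K, X.card ≤ K → Cov (G.LF L) (K * (m + 1)) (⋃ x ∈ X, ((G.inN x ∩ H) ∪ {x})) := by
    intro X hX K hK
    exact (cov_biUnion (h.lf G.trans_empty) (m + 1) X _ fun x hx =>
      (hX x hx).2.union (cov_one (h.lf (G.trans_singleton x)))).le (h.lf G.trans_empty)
      (Nat.mul_le_mul_right _ hK)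
  rcases hKs G {v | v ∈ H ∧ Cov (G.LF L) m (G.inN v ∩ H)} with ⟨X, h1, h2, h3⟩ | ⟨B, h1, h2, h3⟩
  · refine (key X h1 K h2).mono fun v hv => ?_
    obtain ⟨x, hx, hvx⟩ := h3 v hv
    refine Set.mem_biUnion (x := x) hx ?_
    rcases hvx with hvx | hvx
    · exact Or.inr hvx
    · exact Or.inl ⟨hvx, hv.1⟩
  · exfalso
    apply hH
    have hlf : G.LF L {v | ∀ b ∈ B, G.adj b v} := by
      intro A hA hAB
      have := h3 d (h.inn A hA _ fun b hb a ha => hAB ha b (by simpa using hb))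
      omega
    refine ((key B h1 s h2).union (cov_one hlf)).mono fun v hv => ?_
    by_cases hq : ∀ b ∈ B, G.adj b v
    · exact Or.inr hq
    · push Not at hq
      obtain ⟨b, hb, hbv⟩ := hq
      left
      refine Set.mem_biUnion (x := b) hb ?_
      by_cases hav : v = b
      · exact Or.inr hav
      · exact Or.inl ⟨(G.total v b hav).resolve_right hbv, hv⟩

theorem exists_w (d ℓ m : ℕ) (ι : Type) [Fintype ι] : ∃ f : ℕ,
    ∀ (G : Tournament) (L : Set (Set G.V)), Hyp d ℓ G L → ∀ (H : Set G.V) (O : ι → Set G.V),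
    ¬ Cov (G.LF L) f H → (∀ i, ¬ Cov (G.LF L) f (O i)) →
    ∃ w ∈ H, (∀ i, ¬ Cov (G.LF L) m (G.outN w ∩ O i)) ∧ ¬ Cov (G.LF L) m (G.outN w ∩ H) ∧
      ¬ Cov (G.LF L) m (G.inN w ∩ H) := by
  classical
  obtain ⟨K, f, hf⟩ := exists_inner d ℓ m
  refine ⟨f + (ℓ * (m + 1) + d) + (Fintype.card ι * 1 + 1 + K), fun G L h H O hH hO => ?_⟩
  have he := h.lf G.trans_empty
  by_contra hcon
  push Not at hcon
  apply hH
  have h1 := cov_biUnion he 1 Finset.univ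
    (fun i => {v | Cov (G.LF L) m (G.outN v ∩ O i)}) (fun i _ =>
      cov_one (h.out fun hc => hO i (hc.le he (by omega))))
  have h2 := cov_one (h.out (m := m) fun hc => hH (hc.le he (by omega)))
  have h3 := hf G L h H fun hc => hH (hc.le he (by omega))
  refine (((h1.union h2).union h3).le he (by rw [Finset.card_univ]; omega)).mono fun v hv => ?_
  by_cases hv1 : ∃ i, Cov (G.LF L) m (G.outN v ∩ O i)
  · obtain ⟨i, hi⟩ := hv1
    exact Or.inl (Or.inl (Set.mem_biUnion (x := i) (by simp) hi))
  by_cases hv2 : Cov (G.LF L) m (G.outN v ∩ H)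
  · exact Or.inl (Or.inr hv2)
  · exact Or.inr ⟨hv, hcon v hv (fun i hi => hv1 ⟨i, hi⟩) hv2⟩

/-- common out-neighbours -/
def cOut (G : Tournament) (X : Set G.V) : Set G.V := {v | ∀ x ∈ X, G.adj x v}

theorem main_step (d ℓ k : ℕ) : ∀ (ι : Type) [Fintype ι] (m : ℕ), ∃ f : ℕ,
    ∀ (G : Tournament) (L : Set (Set G.V)), Hyp d ℓ G L → ∀ (H : Set G.V) (O : ι → Set G.V),
    ¬ Cov (G.LF L) f H → (∀ i, ¬ Cov (G.LF L) f (O i)) →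
    ∃ X ⊆ H, G.Ge k X ∧ ∀ i, ¬ Cov (G.LF L) m (G.cOut X ∩ O i) := by
  induction k with
  | zero =>
    intro ι _ m
    refine ⟨m, fun G L h H O _ hO => ⟨∅, by simp, fun j _ => Nat.zero_le j, fun i hc => ?_⟩⟩
    exact hO i (hc.mono fun v hv => ⟨fun x hx => hx.elim, hv⟩)
  | succ k ih =>
    intro ι _ m
    obtain ⟨m2, hm2⟩ := ih ι m
    obtain ⟨m1, hm1⟩ := ih (Option ι) m2
    obtain ⟨f, hf⟩ := exists_w d ℓ m1 ι
    refine ⟨f, fun G L h H O hH hO => ?_⟩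
    obtain ⟨w, hwH, hw1, hw2, hw3⟩ := hf G L h H O hH hO
    obtain ⟨Y, hYH, hY, hYO⟩ := hm1 G L h (G.outN w ∩ H)
      (fun o => o.elim (G.inN w ∩ H) (fun i => G.outN w ∩ O i)) hw2
      (by rintro (_ | i); exacts [hw3, hw1 i])
    obtain ⟨X, hXH, hX, hXO⟩ := hm2 G L h (G.cOut Y ∩ (G.inN w ∩ H))
      (fun i => G.cOut Y ∩ (G.outN w ∩ O i)) (hYO none) (fun i => hYO (some i))
    refine ⟨X ∪ Y ∪ {w}, ?_, ?_, ?_⟩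
    · rintro x ((hx | hx) | rfl)
      · exact (hXH hx).2.2
      · exact (hYH hx).2
      · exact hwH
    · rintro j ⟨C, hC, hcov⟩
      obtain ⟨i, hi⟩ := Set.mem_iUnion.1 (hcov (Or.inr rfl : w ∈ _))
      rcases j with _ | j
      · exact i.elim0
      by_contra hlt
      have hx : ∃ x ∈ X, x ∈ C i := by
        by_contra hcon
        push Not at hcon
        have := hX j (cov_unused C hC (fun x hx => hcov (Or.inl (Or.inl hx))) i hcon)
        omega
      have hy : ∃ x ∈ Y, x ∈ C i := by
        by_contra hcon
        push Not at hcon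
        have := hY j (cov_unused C hC (fun x hx => hcov (Or.inl (Or.inr hx))) i hcon)
        omega
      obtain ⟨x, hx, hxi⟩ := hx
      obtain ⟨y, hy, hyi⟩ := hy
      exact hC i w hi y hyi x hxi (hYH hy).1 ((hXH hx).1 y hy) (hXH hx).2.1
    · intro i hc
      refine hXO i (hc.mono ?_)
      rintro v ⟨h1, h2, h3, h4⟩
      refine ⟨?_, h4⟩
      rintro x ((hx | hx) | rfl)
      · exact h1 x hx
      · exact h2 x hx
      · exact h3

end Tournament

open Tournament in
theorem law_cov (d ℓ : ℕ) : ∃ n : ℕ, ∀ (G : Tournament) (L : Set (Set G.V)),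
    Hyp d ℓ G L → Cov (G.LF L) n Set.univ := by
  obtain ⟨f, hf⟩ := main_step d ℓ (d + 1) Unit 1
  refine ⟨f, fun G L h => ?_⟩
  by_contra hcon
  obtain ⟨X, -, hX, hXO⟩ := hf G L h Set.univ (fun _ => Set.univ) hcon (fun _ => hcon)
  refine hXO () (cov_one ?_)
  intro A hA hAX
  have := hX d (h.inn A hA X fun x hx a ha => (hAX ha).1 x hx)
  omega

/-- For all `d, ℓ` there is `n` such that for every tournament `G` and law `L`
of order at most `ℓ`, if `χ_L(G) > n` then some `A ∈ L` has a set `Q` disjoint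
from `A` with `Q ⇒ A` and `χ(Q) ≥ d`. -/
theorem law_in (d ℓ : ℕ) :
    ∃ n : ℕ, ∀ (G : Tournament) (L : Set (Set G.V)),
      G.IsLaw L → (∀ A ∈ L, A.ncard ≤ ℓ) → n < G.chiLaw L →
      ∃ A ∈ L, ∃ Q : Set G.V, Disjoint Q A ∧ G.CompleteTo Q A ∧ d ≤ G.chiOn Q := by
  obtain ⟨n, hn⟩ := law_cov d ℓ
  refine ⟨n, fun G L hL hord hlt => ?_⟩
  by_contra hcon
  push Not at hcon
  have hyp : Tournament.Hyp d ℓ G L := by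
    refine ⟨hL, hord, fun A hA Q hQ => ?_⟩
    have h1 := hcon A hA Q (Set.disjoint_left.2 fun x hx hx' => G.irr x (hQ x hx x hx')) hQ
    have hne : {k | Cov G.IsTransitiveSet k Q}.Nonempty := by
      classical
      refine ⟨_, (cov_biUnion G.trans_empty 1 Finset.univ (fun v : G.V => {v})
        (fun v _ => cov_one (G.trans_singleton v))).mono ?_⟩
      intro v _
      simp
    exact Cov.le G.trans_empty (Nat.sInf_mem hne) h1.le
  obtain ⟨C, h1, h2⟩ := hn G L hyp
  have : G.chiLaw L ≤ n :=
    Nat.sInf_le ⟨C, h1, fun v => Set.mem_iUnion.1 (h2 (Set.mem_univ v))⟩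
  omega
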